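/- arXiv:2401.05523 — 2 statements merged into one kernel-verified Lean document; each statement's English description precedes it below -/
import Mathlib

section
/- If G is a König-Egerváry graph and v ∈ V(G) - core(G), then G - v is a König-Egerváry graph. -/
open SimpleGraph

variable {V : Type*}

/-- A set of vertices is independent: no two of its vertices are adjacent. -/
def IsIndep (G : SimpleGraph V) (s : Set V) : Prop :=
  s.Pairwise fun a b => ¬ G.Adj a b

/-- The independence number α(G). -/
noncomputable def alphaNum (G : SimpleGraph V) : ℕ :=
  sSup {n | ∃ s : Set V, IsIndep G s ∧ s.ncard = n}

/-- The matching number μ(G). -/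
noncomputable def muNum (G : SimpleGraph V) : ℕ :=
  sSup {n | ∃ M : SimpleGraph.Subgraph G, M.IsMatching ∧ M.edgeSet.ncard = n}

/-- The neighborhood N(A) of a set of vertices. -/
def nbhd (G : SimpleGraph V) (A : Set V) : Set V := {v | ∃ a ∈ A, G.Adj a v}

/-- The difference d(A) = |A| - |N(A)| of a set of vertices. -/
noncomputable def diffSet (G : SimpleGraph V) (A : Set V) : ℤ :=
  (A.ncard : ℤ) - (nbhd G A).ncard

/-- The critical difference d(G). -/
noncomputable def critDiff (G : SimpleGraph V) : ℤ :=
  sSup {d | ∃ I : Set V, IsIndep G I ∧ diffSet G I = d}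

/-- A critical independent set: an independent set attaining the critical difference. -/
def IsCriticalIndep (G : SimpleGraph V) (A : Set V) : Prop :=
  IsIndep G A ∧ diffSet G A = critDiff G

/-- ker(G): the intersection of all critical independent sets. -/
noncomputable def kerSet (G : SimpleGraph V) : Set V :=
  ⋂₀ {A | IsCriticalIndep G A}

/-- A maximum independent set. -/
noncomputable def IsMaxIndep (G : SimpleGraph V) (S : Set V) : Prop :=
  IsIndep G S ∧ S.ncard = alphaNum G

/-- core(G): the intersection of all maximum independent sets. -/
noncomputable def coreSet (G : SimpleGraph V) : Set V :=
  ⋂₀ {S | IsMaxIndep G S}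

/-- A König–Egerváry graph: α(G) + μ(G) = n(G). -/
def KonigEgervary (G : SimpleGraph V) : Prop :=
  alphaNum G + muNum G = Nat.card V

theorem aux_le [Finite V] (G : SimpleGraph V) (s : Set V) (hs : IsIndep G s)
    (M : G.Subgraph) (hM : M.IsMatching) : s.ncard + M.edgeSet.ncard ≤ Nat.card V := by
  have key : ∀ e : Sym2 V, ∃ x, e ∈ M.edgeSet → x ∈ e ∧ x ∉ s := by
    intro e
    induction e with | _ a b
    by_cases hab : M.Adj a b
    · by_cases ha : a ∈ s
      · refine ⟨b, fun _ => ⟨by simp, fun hb => ?_⟩⟩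
        exact hs ha hb hab.ne hab.adj_sub
      · exact ⟨a, fun _ => ⟨by simp, ha⟩⟩
    · exact ⟨a, fun h => absurd h hab⟩
  choose f hf using key
  have h1 : M.edgeSet.ncard ≤ (sᶜ).ncard := by
    refine Set.ncard_le_ncard_of_injOn f (fun e he => (hf e he).2) ?_ (Set.toFinite _)
    intro e he e' he' hee
    have h2 := (hf e he).1
    have h3 := (hf e' he').1
    rw [← hee] at h3
    generalize f e = x at h2 h3
    obtain ⟨y, rfl⟩ := h2
    obtain ⟨z, rfl⟩ := h3
    have hy : M.Adj x y := he
    have hz : M.Adj x z := he'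
    obtain ⟨w, _, hw⟩ := hM (M.edge_vert hy)
    rw [hw y hy, hw z hz]
  have := Set.ncard_add_ncard_compl s
  omega

theorem alpha_bdd [Finite V] (G : SimpleGraph V) :
    BddAbove {n | ∃ s : Set V, IsIndep G s ∧ s.ncard = n} :=
  ⟨Nat.card V, by rintro n ⟨s, _, rfl⟩; exact Set.ncard_le_card s⟩

theorem empty_matching (G : SimpleGraph V) : (⊥ : G.Subgraph).IsMatching := by
  intro x hx
  simp at hx

theorem mu_bdd [Finite V] (G : SimpleGraph V) :
    BddAbove {n | ∃ M : SimpleGraph.Subgraph G, M.IsMatching ∧ M.edgeSet.ncard = n} :=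
  ⟨Nat.card V, by
    rintro n ⟨M, hM, rfl⟩
    have := aux_le G ∅ (by simp [IsIndep]) M hM
    omega⟩

theorem mu_attained [Finite V] (G : SimpleGraph V) :
    ∃ M : SimpleGraph.Subgraph G, M.IsMatching ∧ M.edgeSet.ncard = muNum G :=
  Nat.sSup_mem (s := {n | ∃ M : SimpleGraph.Subgraph G, M.IsMatching ∧ M.edgeSet.ncard = n})
    ⟨_, ⊥, empty_matching G, rfl⟩ (mu_bdd G)

theorem alpha_attained [Finite V] (G : SimpleGraph V) :
    ∃ s : Set V, IsIndep G s ∧ s.ncard = alphaNum G :=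
  Nat.sSup_mem (s := {n | ∃ s : Set V, IsIndep G s ∧ s.ncard = n})
    ⟨_, ∅, by simp [IsIndep], rfl⟩ (alpha_bdd G)

theorem mu_del [Finite V] (G : SimpleGraph V) (v : V) :
    muNum G ≤ muNum (G.induce ({v}ᶜ : Set V)) + 1 := by
  obtain ⟨M, hM, hc⟩ := mu_attained G
  let M' : (G.induce ({v}ᶜ : Set V)).Subgraph :=
    { verts := {x | ∃ y : ({v}ᶜ : Set V), M.Adj x.1 y.1}
      Adj := fun x y => M.Adj x.1 y.1
      adj_sub := fun h => M.adj_sub h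
      edge_vert := fun h => ⟨_, h⟩
      symm := ⟨fun _ _ h => M.symm.symm _ _ h⟩ }
  have hM' : M'.IsMatching := by
    rintro x ⟨y, hy⟩
    refine ⟨y, hy, fun z hz => Subtype.ext ?_⟩
    obtain ⟨w, _, hw⟩ := hM (M.edge_vert hy)
    rw [hw y hy, hw z hz]
  have h1 : M'.edgeSet.ncard ≤ muNum (G.induce ({v}ᶜ : Set V)) :=
    le_csSup (mu_bdd _) ⟨M', hM', rfl⟩
  have h2 : ∃ e : Sym2 V, M.edgeSet ⊆ insert e (Sym2.map Subtype.val '' M'.edgeSet) := by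
    have gen : ∀ a b, M.Adj a b → a ≠ v → b ≠ v →
        s(a, b) ∈ Sym2.map Subtype.val '' M'.edgeSet := by
      intro a b hab ha hb
      exact ⟨s(⟨a, ha⟩, ⟨b, hb⟩), hab, rfl⟩
    by_cases hv : ∃ w, M.Adj v w
    · obtain ⟨w, hw⟩ := hv
      have uni : ∀ b, M.Adj v b → b = w := by
        intro b hb
        obtain ⟨u, _, hu⟩ := hM (M.edge_vert hw)
        rw [hu b hb, hu w hw]
      refine ⟨s(v, w), fun e he => ?_⟩
      induction e with | _ a b
      have hab : M.Adj a b := he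
      by_cases ha : a = v
      · subst ha
        left; rw [uni b hab]
      by_cases hb : b = v
      · subst hb
        left; rw [uni a hab.symm, Sym2.eq_swap]
      exact Or.inr (gen a b hab ha hb)
    · push Not at hv
      refine ⟨s(v, v), fun e he => ?_⟩
      induction e with | _ a b
      have hab : M.Adj a b := he
      refine Or.inr (gen a b hab ?_ ?_)
      · rintro rfl; exact hv _ hab
      · rintro rfl; exact hv _ hab.symm
  obtain ⟨e, he⟩ := h2
  have h3 := Set.ncard_le_ncard he (Set.toFinite _)
  have h4 := Set.ncard_insert_le e (Sym2.map Subtype.val '' M'.edgeSet)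
  have h5 := Set.ncard_image_le (f := Sym2.map Subtype.val) (Set.toFinite M'.edgeSet)
  omega

theorem stmt_14 [Fintype V] (G : SimpleGraph V) (hKE : KonigEgervary G) (v : V)
    (hv : v ∉ coreSet G) :
    KonigEgervary (G.induce ({v}ᶜ : Set V)) := by
  have hmu := mu_del G v
  simp only [coreSet, Set.mem_sInter, Set.mem_setOf_eq, not_forall] at hv
  obtain ⟨S, ⟨hS, hSc⟩, hvS⟩ := hv
  have hal : alphaNum G ≤ alphaNum (G.induce ({v}ᶜ : Set V)) := by
    refine le_csSup (alpha_bdd _) ⟨Subtype.val ⁻¹' S, ?_, ?_⟩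
    · intro a ha b hb hab hadj
      exact hS ha hb (fun h => hab (Subtype.ext h)) hadj
    · rw [← hSc]
      refine Set.ncard_preimage_of_injective_subset_range Subtype.val_injective ?_
      intro x hx
      exact ⟨⟨x, fun h => hvS (h ▸ hx)⟩, rfl⟩
  obtain ⟨s, hs, hsc⟩ := alpha_attained (G.induce ({v}ᶜ : Set V))
  obtain ⟨M, hM, hMc⟩ := mu_attained (G.induce ({v}ᶜ : Set V))
  have hle := aux_le _ s hs M hM
  have hcard := Set.ncard_add_ncard_compl ({v} : Set V)
  rw [Set.ncard_singleton] at hcard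
  have : Nat.card ({v}ᶜ : Set V) = ({v}ᶜ : Set V).ncard := rfl
  unfold KonigEgervary at hKE ⊢
  omega
end

section
/- If G is a König-Egerváry graph, then the number of edges e such that G - e is König-Egerváry is at least m(G) - |core(G)| + |ker(G)|, where m(G) is the number of edges. -/
open SimpleGraph

variable {V : Type*}

/-- `f` matches `P` into `S` injectively along edges of `H`. -/
def Mt (H : SimpleGraph V) (P S : Set V) (f : V → V) : Prop :=
  Set.InjOn f P ∧ ∀ z ∈ P, f z ∈ S ∧ H.Adj z (f z)

theorem hall_alt [Fintype V] (P Q : Set V) (r : V → V → Prop) :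
    (∃ f : V → V, Set.InjOn f P ∧ ∀ z ∈ P, f z ∈ Q ∧ r z (f z)) ∨
    ∃ Y ⊆ P, {q ∈ Q | ∃ z ∈ Y, r z q}.ncard < Y.ncard := by
  classical
  by_cases h : ∀ s : Finset P, s.card ≤
      (s.biUnion fun z => Finset.univ.filter fun q => q ∈ Q ∧ r z q).card
  · left
    obtain ⟨f, hf, hf'⟩ := (Finset.all_card_le_biUnion_card_iff_exists_injective _).1 h
    refine ⟨fun v => if hv : v ∈ P then f ⟨v, hv⟩ else v, ?_, ?_⟩
    · intro a ha b hb hab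
      simp only [ha, hb, dif_pos] at hab
      have := hf hab
      simpa using this
    · intro z hz
      have := hf' ⟨z, hz⟩
      simpa [hz] using this
  · right
    push Not at h
    obtain ⟨s, hs⟩ := h
    refine ⟨(fun z : P => (z : V)) '' (s : Set P), ?_, ?_⟩
    · rintro _ ⟨z, _, rfl⟩
      exact z.2
    · rw [Set.ncard_image_of_injective _ Subtype.val_injective, Set.ncard_coe_finset]
      refine lt_of_le_of_lt ?_ hs
      rw [← Set.ncard_coe_finset]
      apply Set.ncard_le_ncard _ (Set.toFinite _)
      rintro q ⟨hq, z, ⟨w, hw, rfl⟩, hr⟩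
      simp only [Finset.coe_biUnion, Set.mem_iUnion]
      exact ⟨w, hw, by simp [hq, hr]⟩

theorem le_alpha [Fintype V] {H : SimpleGraph V} {S : Set V} (h : IsIndep H S) :
    S.ncard ≤ alphaNum H := by
  apply le_csSup
  · refine ⟨Nat.card V, ?_⟩
    rintro _ ⟨s, _, rfl⟩
    exact Set.ncard_le_card s
  · exact ⟨S, h, rfl⟩

theorem exists_max [Fintype V] (H : SimpleGraph V) : ∃ S, IsMaxIndep H S := by
  have : alphaNum H ∈ {n | ∃ s : Set V, IsIndep H s ∧ s.ncard = n} := by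
    apply Nat.sSup_mem
    · exact ⟨0, ∅, by simp [IsIndep], by simp⟩
    · refine ⟨Nat.card V, ?_⟩
      rintro _ ⟨s, _, rfl⟩
      exact Set.ncard_le_card s
  exact this

theorem bdd_mu [Fintype V] (H : SimpleGraph V) :
    BddAbove {n | ∃ M : SimpleGraph.Subgraph H, M.IsMatching ∧ M.edgeSet.ncard = n} := by
  refine ⟨Nat.card (Sym2 V), ?_⟩
  rintro _ ⟨s, _, rfl⟩
  exact Set.ncard_le_card _

theorem exists_mu [Fintype V] (H : SimpleGraph V) :
    ∃ M : SimpleGraph.Subgraph H, M.IsMatching ∧ M.edgeSet.ncard = muNum H := by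
  have : muNum H ∈ {n | ∃ M : SimpleGraph.Subgraph H, M.IsMatching ∧ M.edgeSet.ncard = n} := by
    apply Nat.sSup_mem
    · refine ⟨0, ⊥, ?_, ?_⟩
      · intro v hv
        simp at hv
      · simp
    · exact bdd_mu H
  exact this

/-- The matching number is at least the size of an injectively matched set. -/
theorem le_mu [Fintype V] {H : SimpleGraph V} {P S : Set V} {f : V → V}
    (hd : ∀ z ∈ P, z ∉ S) (hf : Mt H P S f) : P.ncard ≤ muNum H := by
  let M : SimpleGraph.Subgraph H :=
    { verts := {v | ∃ w, (v ∈ P ∧ w = f v) ∨ (w ∈ P ∧ v = f w)}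
      Adj := fun a b => (a ∈ P ∧ b = f a) ∨ (b ∈ P ∧ a = f b)
      adj_sub := by
        rintro a b (⟨h, rfl⟩ | ⟨h, rfl⟩)
        · exact (hf.2 a h).2
        · exact (hf.2 b h).2.symm
      edge_vert := by
        intro a b h
        exact ⟨b, h⟩
      symm := ⟨fun a b h => h.symm⟩ }
  have hM : M.IsMatching := by
    rintro v ⟨w, hw⟩
    refine ⟨w, hw, ?_⟩
    intro u hu
    change (v ∈ P ∧ u = f v) ∨ (u ∈ P ∧ v = f u) at hu
    rcases hw with ⟨h1, h2⟩ | ⟨h1, h2⟩ <;> rcases hu with ⟨h3, h4⟩ | ⟨h3, h4⟩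
    · rw [h2, h4]
    · exact absurd (h4 ▸ (hf.2 u h3).1) (hd v h1)
    · exact absurd (h2 ▸ (hf.2 w h1).1) (hd v h3)
    · exact hf.1 h3 h1 (h4.symm.trans h2)
  have hinj : Set.InjOn (fun z => s(z, f z)) P := by
    intro a ha b hb hab
    simp only [Sym2.eq_iff] at hab
    rcases hab with h | h
    · exact h.1
    · exact absurd (h.1 ▸ (hf.2 b hb).1) (hd a ha)
  rw [← Set.ncard_image_of_injOn hinj]
  refine le_trans (Set.ncard_le_ncard (t := M.edgeSet) ?_ (Set.toFinite _))
    (le_csSup (bdd_mu H) ⟨M, hM, rfl⟩)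
  rintro _ ⟨z, hz, rfl⟩
  rw [SimpleGraph.Subgraph.mem_edgeSet]
  exact Or.inl ⟨hz, rfl⟩

/-- Matching versus complement of an independent set. -/
theorem matching_indep [Fintype V] {H : SimpleGraph V} {S : Set V} (hS : IsIndep H S)
    (M : SimpleGraph.Subgraph H) (hM : M.IsMatching) :
    M.edgeSet.ncard ≤ Sᶜ.ncard ∧ (M.edgeSet.ncard = Sᶜ.ncard → ∃ f, Mt H Sᶜ S f) := by
  classical
  have h0 : ∀ v, ∃ w, v ∈ M.verts → M.Adj v w := by
    intro v
    by_cases hv : v ∈ M.verts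
    · obtain ⟨w, hw, _⟩ := hM hv
      exact ⟨w, fun _ => hw⟩
    · exact ⟨v, fun h => absurd h hv⟩
  choose f hf using h0
  have huniq : ∀ v w, M.Adj v w → w = f v := by
    intro v w h
    exact (hM h.fst_mem).unique h (hf v h.fst_mem)
  have hsub : M.edgeSet ⊆ (fun z => s(z, f z)) '' (Sᶜ ∩ M.verts) := by
    intro e
    induction e using Sym2.ind with
    | _ a b =>
      intro he
      rw [SimpleGraph.Subgraph.mem_edgeSet] at he
      by_cases ha : a ∈ S
      · have hb : b ∉ S := fun hb => hS ha hb he.adj_sub.ne he.adj_sub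
        refine ⟨b, ⟨hb, he.snd_mem⟩, ?_⟩
        simp only [← huniq b a he.symm]
        exact Sym2.eq_swap
      · refine ⟨a, ⟨ha, he.fst_mem⟩, ?_⟩
        simp only [← huniq a b he]
  have h1 := Set.ncard_le_ncard hsub (Set.toFinite _)
  have h2 : ((fun z => s(z, f z)) '' (Sᶜ ∩ M.verts)).ncard ≤ (Sᶜ ∩ M.verts).ncard :=
    Set.ncard_image_le (Set.toFinite _)
  have h3 : (Sᶜ ∩ M.verts).ncard ≤ Sᶜ.ncard :=
    Set.ncard_le_ncard Set.inter_subset_left (Set.toFinite _)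
  refine ⟨by omega, fun heq => ⟨f, ?_⟩⟩
  have h4 : Sᶜ ∩ M.verts = Sᶜ :=
    Set.eq_of_subset_of_ncard_le Set.inter_subset_left (by omega) (Set.toFinite _)
  have hinj : Set.InjOn (fun z => s(z, f z)) (Sᶜ ∩ M.verts) :=
    (Set.ncard_image_iff (Set.toFinite _)).1 (by omega)
  rw [h4] at hinj
  have hv : ∀ z ∈ Sᶜ, z ∈ M.verts := fun z hz => (h4.symm ▸ hz : z ∈ Sᶜ ∩ M.verts).2
  constructor
  · intro a ha b hb hab
    have e1 := huniq _ _ (hf a (hv a ha)).symm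
    have e2 := huniq _ _ (hf b (hv b hb)).symm
    rw [e1, e2, hab]
  · intro z hz
    have hadj := hf z (hv z hz)
    refine ⟨?_, hadj.adj_sub⟩
    by_contra hn
    have e1 := huniq _ _ hadj.symm
    have : z = f z := hinj hz hn (by
      simp only [← e1]
      exact Sym2.eq_swap)
    exact hadj.adj_sub.ne this

theorem ncard_add [Fintype V] (S : Set V) : S.ncard + Sᶜ.ncard = Nat.card V :=
  Set.ncard_add_ncard_compl S

theorem alpha_add_mu_le [Fintype V] (H : SimpleGraph V) :
    alphaNum H + muNum H ≤ Nat.card V := by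
  obtain ⟨S, hS, hc⟩ := exists_max H
  obtain ⟨M, hM, hm⟩ := exists_mu H
  have := (matching_indep hS M hM).1
  have := ncard_add S
  omega

theorem exists_Mt [Fintype V] {H : SimpleGraph V} (hK : KonigEgervary H) {S : Set V}
    (hS : IsMaxIndep H S) : ∃ f, Mt H Sᶜ S f := by
  obtain ⟨M, hM, hm⟩ := exists_mu H
  apply (matching_indep hS.1 M hM).2
  have := ncard_add S
  have := hS.2
  unfold KonigEgervary at hK
  omega

theorem diff_le [Fintype V] {G : SimpleGraph V} {S : Set V} {f : V → V} (hf : Mt G Sᶜ S f)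
    (I : Set V) : diffSet G I ≤ (S.ncard : ℤ) - Sᶜ.ncard := by
  have hF : (f '' Sᶜ).ncard = Sᶜ.ncard := Set.ncard_image_of_injOn hf.1
  have hFS : f '' Sᶜ ⊆ S := by
    rintro _ ⟨z, hz, rfl⟩
    exact (hf.2 z hz).1
  have a1 : (S \ (f '' Sᶜ)).ncard + (f '' Sᶜ).ncard = S.ncard :=
    Set.ncard_sdiff_add_ncard_of_subset hFS (Set.toFinite _)
  have a2 : (I ∩ S).ncard + (I \ S).ncard = I.ncard :=
    Set.ncard_inter_add_ncard_sdiff_eq_ncard _ _ (Set.toFinite _)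
  have a3 : (nbhd G I ∩ S).ncard + (nbhd G I \ S).ncard = (nbhd G I).ncard :=
    Set.ncard_inter_add_ncard_sdiff_eq_ncard _ _ (Set.toFinite _)
  have a4 : (I \ S).ncard ≤ (nbhd G I ∩ S).ncard := by
    rw [← Set.ncard_image_of_injOn (hf.1.mono (s₁ := I \ S) fun z hz => hz.2)]
    apply Set.ncard_le_ncard _ (Set.toFinite _)
    rintro _ ⟨z, hz, rfl⟩
    exact ⟨⟨z, hz.1, (hf.2 z hz.2).2⟩, (hf.2 z hz.2).1⟩
  have a5 : (I ∩ S).ncard ≤ (f '' (nbhd G I \ S) ∪ (S \ (f '' Sᶜ))).ncard := by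
    apply Set.ncard_le_ncard _ (Set.toFinite _)
    rintro v ⟨hv, hvS⟩
    by_cases h : v ∈ f '' Sᶜ
    · left
      obtain ⟨z, hz, rfl⟩ := h
      exact ⟨z, ⟨⟨f z, hv, (hf.2 z hz).2.symm⟩, hz⟩, rfl⟩
    · exact Or.inr ⟨hvS, h⟩
  have a6 := Set.ncard_union_le (f '' (nbhd G I \ S)) (S \ (f '' Sᶜ))
  have a7 : (f '' (nbhd G I \ S)).ncard ≤ _ := Set.ncard_image_le (Set.toFinite _)
  unfold diffSet
  omega

/-- Removing a Hall-tight part of a maximum independent set leaves a critical set. -/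
theorem crit_of [Fintype V] {G : SimpleGraph V} {S : Set V} (hS : IsIndep G S) {f : V → V}
    (hf : Mt G Sᶜ S f) (Y : Set V) (hY : Y ⊆ Sᶜ)
    (hc : {q ∈ S | ∃ z ∈ Y, G.Adj z q}.ncard ≤ Y.ncard) :
    IsCriticalIndep G (S \ {q ∈ S | ∃ z ∈ Y, G.Adj z q}) := by
  set T := {q ∈ S | ∃ z ∈ Y, G.Adj z q} with hT
  have hind : IsIndep G (S \ T) := fun a ha b hb h => hS ha.1 hb.1 h
  have hge : (S.ncard : ℤ) - Sᶜ.ncard ≤ diffSet G (S \ T) := by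
    have a1 : (S \ T).ncard + T.ncard = S.ncard :=
      Set.ncard_sdiff_add_ncard_of_subset (fun q hq => hq.1) (Set.toFinite _)
    have a2 : (Sᶜ \ Y).ncard + Y.ncard = Sᶜ.ncard :=
      Set.ncard_sdiff_add_ncard_of_subset hY (Set.toFinite _)
    have a3 : (nbhd G (S \ T)).ncard ≤ (Sᶜ \ Y).ncard := by
      apply Set.ncard_le_ncard _ (Set.toFinite _)
      rintro v ⟨a, ha, hav⟩
      refine ⟨fun hv => hS ha.1 hv hav.ne hav, fun hv => ha.2 ⟨ha.1, v, hv, hav.symm⟩⟩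
    unfold diffSet
    omega
  refine ⟨hind, ?_⟩
  have hg : IsGreatest {d | ∃ I : Set V, IsIndep G I ∧ diffSet G I = d} (diffSet G (S \ T)) := by
    refine ⟨⟨_, hind, rfl⟩, ?_⟩
    rintro _ ⟨I, _, rfl⟩
    exact (diff_le hf I).trans hge
  exact hg.csSup_eq.symm

theorem ker_sub_core [Fintype V] {G : SimpleGraph V} (hK : KonigEgervary G) :
    kerSet G ⊆ coreSet G := by
  intro v hv S hS
  obtain ⟨f, hf⟩ := exists_Mt hK hS
  have := hv _ (crit_of hS.1 hf ∅ (Set.empty_subset _) (by simp))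
  exact this.1

/-- A bad edge meets every saturating matching. -/
theorem bad_used [Fintype V] {G : SimpleGraph V} (e : Sym2 V)
    (hb : ¬ KonigEgervary (G.deleteEdges {e})) {S : Set V} (hS : IsMaxIndep G S)
    {f : V → V} (hf : Mt G Sᶜ S f) : ∃ z ∈ Sᶜ, s(z, f z) = e := by
  by_contra hn
  push Not at hn
  apply hb
  have h1 : Sᶜ.ncard ≤ muNum (G.deleteEdges {e}) := by
    apply le_mu (S := S) (f := f) (fun z hz => hz)
    refine ⟨hf.1, fun z hz => ⟨(hf.2 z hz).1, ?_⟩⟩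
    rw [SimpleGraph.deleteEdges_adj]
    exact ⟨(hf.2 z hz).2, by simpa using hn z hz⟩
  have h2 : S.ncard ≤ alphaNum (G.deleteEdges {e}) := by
    apply le_alpha
    intro a ha b hb' hne h
    exact hS.1 ha hb' hne (SimpleGraph.deleteEdges_le _ h)
  have h3 := alpha_add_mu_le (G.deleteEdges {e})
  have := ncard_add S
  unfold KonigEgervary
  omega

theorem bad_alpha [Fintype V] {G : SimpleGraph V} (hK : KonigEgervary G) (e : Sym2 V)
    (hb : ¬ KonigEgervary (G.deleteEdges {e})) (A : Set V)
    (hA : IsIndep (G.deleteEdges {e}) A) : A.ncard ≤ alphaNum G := by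
  by_contra hn
  push Not at hn
  apply hb
  obtain ⟨S, hS⟩ := exists_max G
  obtain ⟨f, hf⟩ := exists_Mt hK hS
  obtain ⟨z, hz, hze⟩ := bad_used e hb hS hf
  have h1 : (Sᶜ \ {z}).ncard ≤ muNum (G.deleteEdges {e}) := by
    apply le_mu (S := S) (f := f) (fun z hz => hz.1)
    refine ⟨hf.1.mono fun z hz => hz.1, fun w hw => ⟨(hf.2 w hw.1).1, ?_⟩⟩
    rw [SimpleGraph.deleteEdges_adj]
    refine ⟨(hf.2 w hw.1).2, fun h => hw.2 ?_⟩
    rw [Set.mem_singleton_iff, ← hze, Sym2.eq_iff] at h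
    rcases h with h | h
    · exact h.1
    · exact absurd (h.1 ▸ (hf.2 z hz).1) hw.1
  have h2 : (Sᶜ \ {z}).ncard + 1 = Sᶜ.ncard := Set.ncard_sdiff_singleton_add_one hz (Set.toFinite _)
  have h3 := alpha_add_mu_le (G.deleteEdges {e})
  have h4 := le_alpha hA
  have := ncard_add S
  have := hS.2
  unfold KonigEgervary at *
  omega

theorem not_ker [Fintype V] {G : SimpleGraph V} (hK : KonigEgervary G) {x y : V}
    (hb : ¬ KonigEgervary (G.deleteEdges {s(x, y)})) (hx : x ∈ coreSet G) :
    x ∉ kerSet G := by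
  obtain ⟨S, hS⟩ := exists_max G
  obtain ⟨f, hf⟩ := exists_Mt hK hS
  have hxS : x ∈ S := hx S hS
  intro hker
  rcases hall_alt Sᶜ (S \ {x}) G.Adj with ⟨g, hg1, hg2⟩ | ⟨Y, hY, hlt⟩
  · obtain ⟨z, hz, hze⟩ := bad_used _ hb hS (f := g)
      ⟨hg1, fun z hz => ⟨(hg2 z hz).1.1, (hg2 z hz).2⟩⟩
    rw [Sym2.eq_iff] at hze
    rcases hze with h | h
    · exact hz (h.1 ▸ hxS)
    · exact (hg2 z hz).1.2 h.2
  · have hsub : {q ∈ S | ∃ z ∈ Y, G.Adj z q} ⊆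
        insert x {q ∈ S \ {x} | ∃ z ∈ Y, G.Adj z q} := by
      rintro q ⟨hq, h⟩
      by_cases hqx : q = x
      · exact Or.inl hqx
      · exact Or.inr ⟨⟨hq, hqx⟩, h⟩
    have h1 := Set.ncard_le_ncard hsub (Set.toFinite _)
    have h2 := Set.ncard_insert_le x {q ∈ S \ {x} | ∃ z ∈ Y, G.Adj z q}
    have hxB := hker _ (crit_of hS.1 hf Y hY (by omega))
    have h3 : Y.ncard ≤ {q ∈ S \ {x} | ∃ z ∈ Y, G.Adj z q}.ncard := by
      rw [← Set.ncard_image_of_injOn (hf.1.mono hY)]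
      apply Set.ncard_le_ncard _ (Set.toFinite _)
      rintro _ ⟨z, hz, rfl⟩
      have h4 := hf.2 z (hY hz)
      refine ⟨⟨h4.1, fun h => hxB.2 ?_⟩, z, hz, h4.2⟩
      rw [Set.mem_singleton_iff] at h
      exact ⟨hxS, z, hz, h ▸ h4.2⟩
    omega

theorem core_or [Fintype V] {G : SimpleGraph V} (hK : KonigEgervary G) {x y : V}
    (hb : ¬ KonigEgervary (G.deleteEdges {s(x, y)})) :
    x ∈ coreSet G ∨ y ∈ coreSet G := by
  classical
  by_contra hn
  push Not at hn
  obtain ⟨hx, hy⟩ := hn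
  simp only [coreSet, Set.mem_sInter, Set.mem_setOf_eq, not_forall] at hx hy
  obtain ⟨S, hS, hxS⟩ := hx
  obtain ⟨R, hR, hyR⟩ := hy
  obtain ⟨f, hf⟩ := exists_Mt hK hS
  have hyS : y ∈ S := by
    obtain ⟨z, hz, hze⟩ := bad_used _ hb hS hf
    rw [Sym2.eq_iff] at hze
    rcases hze with h | h
    · exact h.2 ▸ (hf.2 z hz).1
    · exact absurd (h.2 ▸ (hf.2 z hz).1) hxS
  rcases hall_alt Sᶜ S (G.deleteEdges {s(x, y)}).Adj with ⟨g, hg1, hg2⟩ | ⟨Y, hY, hlt⟩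
  · obtain ⟨z, hz, hze⟩ := bad_used _ hb hS (f := g)
      ⟨hg1, fun z hz => ⟨(hg2 z hz).1, SimpleGraph.deleteEdges_le _ (hg2 z hz).2⟩⟩
    have := (hg2 z hz).2
    rw [SimpleGraph.deleteEdges_adj] at this
    exact this.2 hze
  · set T := {q ∈ S | ∃ z ∈ Y, (G.deleteEdges {s(x, y)}).Adj z q} with hT
    have hTS : T ⊆ S := fun q hq => hq.1
    -- f maps Y onto insert y T
    have hfY : f '' Y ⊆ insert y T := by
      rintro _ ⟨z, hz, rfl⟩
      have h4 := hf.2 z (hY hz)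
      by_cases h : s(z, f z) = s(x, y)
      · left
        rw [Sym2.eq_iff] at h
        rcases h with h | h
        · exact h.2
        · exact absurd (h.2 ▸ h4.1) hxS
      · right
        refine ⟨h4.1, z, hz, ?_⟩
        rw [SimpleGraph.deleteEdges_adj]
        exact ⟨h4.2, h⟩
    have hcf : (f '' Y).ncard = Y.ncard := Set.ncard_image_of_injOn (hf.1.mono hY)
    have hins := Set.ncard_insert_le y T
    have hfe : f '' Y = insert y T :=
      Set.eq_of_subset_of_ncard_le hfY (by omega) (Set.toFinite _)
    have hTY : (insert y T).ncard = Y.ncard := by rw [← hfe, hcf]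
    have hyT : y ∉ T := by
      intro h
      rw [Set.insert_eq_of_mem h] at hTY
      omega
    -- the part of R outside Y and insert y T is small
    have hsmall : (R \ (Y ∪ insert y T)).ncard ≤ (S \ insert y T).ncard := by
      let g : V → V := fun w => if w ∈ S then w else f w
      have hg : Set.InjOn g (R \ (Y ∪ insert y T)) := by
        intro a ha b hb' hab
        simp only [g] at hab
        split_ifs at hab with h1 h2 h2
        · exact hab
        · have := (hf.2 b h2).2
          rw [← hab] at this
          exact absurd this (hR.1 hb'.1 ha.1 this.ne)
        · have := (hf.2 a h1).2
          rw [hab] at this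
          exact absurd this (hR.1 ha.1 hb'.1 this.ne)
        · exact hf.1 h1 h2 hab
      rw [← Set.ncard_image_of_injOn hg]
      apply Set.ncard_le_ncard _ (Set.toFinite _)
      rintro _ ⟨w, hw, rfl⟩
      simp only [g]
      split_ifs with h1
      · exact ⟨h1, fun h => hw.2 (Or.inr h)⟩
      · refine ⟨(hf.2 w h1).1, fun h => ?_⟩
        rw [← hfe] at h
        obtain ⟨z, hz, hzw⟩ := h
        have := hf.1 (hY hz) h1 hzw
        exact hw.2 (Or.inl (this ▸ hz))
    have hSi : (S \ insert y T).ncard + (insert y T).ncard = S.ncard :=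
      Set.ncard_sdiff_add_ncard_of_subset (Set.insert_subset hyS hTS) (Set.toFinite _)
    have hRi : (R ∩ (Y ∪ insert y T)).ncard + (R \ (Y ∪ insert y T)).ncard = R.ncard :=
      Set.ncard_inter_add_ncard_sdiff_eq_ncard _ _ (Set.toFinite _)
    have hRe : R ∩ (Y ∪ insert y T) = R ∩ (Y ∪ T) := by
      ext v
      constructor
      · rintro ⟨h1, h2 | h2 | h2⟩
        · exact ⟨h1, Or.inl h2⟩
        · exact absurd (h2 ▸ h1) hyR
        · exact ⟨h1, Or.inr h2⟩
      · rintro ⟨h1, h2 | h2⟩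
        · exact ⟨h1, Or.inl h2⟩
        · exact ⟨h1, Or.inr (Or.inr h2)⟩
    have hdis : Disjoint (R ∩ (Y ∪ T)) (S \ T) := by
      rw [Set.disjoint_left]
      rintro v ⟨_, h | h⟩ h'
      · exact hY h h'.1
      · exact h'.2 h
    have hcard := Set.ncard_union_eq hdis (Set.toFinite _) (Set.toFinite _)
    have hST : (S \ T).ncard + T.ncard = S.ncard :=
      Set.ncard_sdiff_add_ncard_of_subset hTS (Set.toFinite _)
    have hcross : ∀ a ∈ R ∩ (Y ∪ T), ∀ b ∈ S \ T,
        ¬ (G.deleteEdges {s(x, y)}).Adj a b := by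
      rintro a ⟨haR, ha | ha⟩ b hb' h
      · exact hb'.2 ⟨hb'.1, a, ha, h⟩
      · have := SimpleGraph.deleteEdges_le _ h
        exact hS.1 (hTS ha) hb'.1 this.ne this
    have hind : IsIndep (G.deleteEdges {s(x, y)}) (R ∩ (Y ∪ T) ∪ S \ T) := by
      rintro a (ha | ha) b (hb' | hb') hne h
      · exact hR.1 ha.1 hb'.1 hne (SimpleGraph.deleteEdges_le _ h)
      · exact hcross a ha b hb' h
      · exact hcross b hb' a ha h.symm
      · exact hS.1 ha.1 hb'.1 hne (SimpleGraph.deleteEdges_le _ h)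
    have hfin := bad_alpha hK _ hb _ hind
    rw [hRe] at hRi
    have := hS.2
    have := hR.2
    omega

theorem bad_vertex [Fintype V] {G : SimpleGraph V} (hK : KonigEgervary G) (e : Sym2 V)
    (hb : ¬ KonigEgervary (G.deleteEdges {e})) : ∃ v ∈ e, v ∈ coreSet G \ kerSet G := by
  induction e using Sym2.ind with
  | _ x y =>
    rcases core_or hK hb with h | h
    · exact ⟨x, Sym2.mem_mk_left x y, h, not_ker hK hb h⟩
    · refine ⟨y, Sym2.mem_mk_right x y, h, not_ker (y := x) hK ?_ h⟩
      rwa [Sym2.eq_swap]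

theorem stmt_19 [Fintype V] (G : SimpleGraph V) (hKE : KonigEgervary G) :
    (G.edgeSet.ncard : ℤ) - (coreSet G).ncard + (kerSet G).ncard ≤
      ({e ∈ G.edgeSet | KonigEgervary (G.deleteEdges {e})}.ncard : ℤ) := by
  classical
  obtain ⟨S, hS⟩ := exists_max G
  obtain ⟨f, hf⟩ := exists_Mt hKE hS
  set A := {e ∈ G.edgeSet | KonigEgervary (G.deleteEdges {e})} with hA
  have h1 : (G.edgeSet \ A).ncard + A.ncard = G.edgeSet.ncard :=
    Set.ncard_sdiff_add_ncard_of_subset (fun e he => he.1) (Set.toFinite _)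
  have h2 : (coreSet G \ kerSet G).ncard + (kerSet G).ncard = (coreSet G).ncard :=
    Set.ncard_sdiff_add_ncard_of_subset (ker_sub_core hKE) (Set.toFinite _)
  have hbad : ∀ e ∈ G.edgeSet \ A, ¬ KonigEgervary (G.deleteEdges {e}) :=
    fun e he h => he.2 ⟨he.1, h⟩
  have h3 : (G.edgeSet \ A).ncard ≤ (coreSet G \ kerSet G).ncard := by
    choose g hg1 hg2 using fun (e : Sym2 V) (he : e ∈ G.edgeSet \ A) =>
      bad_vertex hKE e (hbad e he)
    refine Set.ncard_le_ncard_of_injOn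
      (fun e => if he : e ∈ G.edgeSet \ A then g e he else (Quot.out e).1) ?_ ?_ (Set.toFinite _)
    · intro e he
      simp only [he, dif_pos]
      exact hg2 e he
    · intro e he e' he' heq
      simp only [he, he', dif_pos] at heq
      have m1 := hg1 e he
      have m2 := hg1 e' he'
      rw [← heq] at m2
      generalize g e he = v at m1 m2
      obtain ⟨z, hz, hze⟩ := bad_used e (hbad e he) hS hf
      obtain ⟨w, hw, hwe⟩ := bad_used e' (hbad e' he') hS hf
      rw [← hze, Sym2.mem_iff] at m1
      rw [← hwe, Sym2.mem_iff] at m2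
      have : z = w := by
        rcases m1 with m1 | m1 <;> rcases m2 with m2 | m2
        · exact m1.symm.trans m2
        · exact absurd ((m1.symm.trans m2) ▸ (hf.2 w hw).1) hz
        · exact absurd ((m2.symm.trans m1) ▸ (hf.2 z hz).1) hw
        · exact hf.1 hz hw (m1.symm.trans m2)
      rw [← hze, ← hwe, this]
  omega
end
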